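/- arXiv:2312.16389 — 8 statements merged into one kernel-verified Lean document; each statement's English description precedes it below -/
import Mathlib

section
/- φ vanishes on 2-boundaries and ψ intertwines the boundary of 1-chains with the coboundary of φ: (i) for every finitely supported function y : W × W → X one has φ(∂₂y) = 0, and (ii) for every finitely supported function x : W → X and every ρ ∈ G one has ψ(∂₁x)(ρ) = ρ•φ(x) − φ(x). (This is the commutativity of the diagram relating the chain complex of W with coefficients in X to the cochain complex of G with coefficients in T via the maps φ and ψ.) -/
namespace Stmt0

variable {W G : Type*} [Group W] [Group G]

/-- Conjugation of an element of `C = ker p` by an element of `W`.  Since `C` is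
abelian, this induces the conjugation action of `G = W/C` on `C`. -/
def kerConj (p : W →* G) (w : W) (c : p.ker) : p.ker :=
  ⟨w * c * w⁻¹, by
    have hc : p (c : W) = 1 := c.2
    simp [MonoidHom.mem_ker, hc]⟩

/-- The 2-cocycle `a(σ,τ)` attached to a set-theoretic section `s` of `p`,
determined by `s(σ)·s(τ) = a(σ,τ)·s(στ)`. -/
def cocycleOf (p : W →* G) (s : G → W) (hs : ∀ g : G, p (s g) = g) (σ τ : G) :
    p.ker :=
  ⟨s σ * s τ * (s (σ * τ))⁻¹, by simp [MonoidHom.mem_ker, hs, mul_assoc]⟩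

/-- The kernel part `c` of `w` in the decomposition `w = c · s (p w)`. -/
def cPart (p : W →* G) (s : G → W) (hs : ∀ g : G, p (s g) = g) (w : W) : p.ker :=
  ⟨w * (s (p w))⁻¹, by simp [MonoidHom.mem_ker, hs]⟩

/-- The boundary of a finitely supported 1-chain:
`∂₁x = Σ_w ((p w)⁻¹ • x w − x w)`. -/
def d1 (p : W →* G) {M : Type*} [AddCommGroup M] [DistribMulAction G M]
    (x : W →₀ M) : M :=
  x.sum fun w v => (p w)⁻¹ • v - v

/-- The boundary of a finitely supported 2-chain:
`(∂₂y)(w) = Σ_{w₁} (p w₁)⁻¹ • y(w₁,w) − Σ_{w₁w₂=w} y(w₁,w₂) + Σ_{w₂} y(w,w₂)`. -/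
noncomputable def d2 (p : W →* G) {M : Type*} [AddCommGroup M] [DistribMulAction G M]
    (y : (W × W) →₀ M) : W →₀ M :=
  (y.sum fun q v => Finsupp.single q.2 ((p q.1)⁻¹ • v))
    - (y.sum fun q v => Finsupp.single (q.1 * q.2) v)
    + (y.sum fun q v => Finsupp.single q.1 v)

/-- The map `φ` on 1-chains:
`φ(x) = −Σ_{σ,τ∈G} Σ_{c∈C} ⟨σ•x(c·s(τ)), a(σ,τ)·(σ•c)⟩`, the inner double sum
being reindexed by `w = c·s(τ)` (so `τ = p w` and `c = w·s(p w)⁻¹`). -/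
def phiMap (p : W →* G) [Fintype G] (s : G → W) (hs : ∀ g : G, p (s g) = g)
    {M R : Type*} [AddCommGroup M] [DistribMulAction G M] [AddCommGroup R]
    (pair : M → p.ker → R) (x : W →₀ M) : R :=
  - ∑ σ : G, x.sum fun w v =>
      pair (σ • v) (cocycleOf p s hs σ (p w) * kerConj p (s σ) (cPart p s hs w))

/-- The map `ψ`: `ψ(μ)(ρ) = Σ_{σ∈G} ⟨(ρσ)•μ, a(ρ,σ)⟩`. -/
def psiMap (p : W →* G) [Fintype G] (s : G → W) (hs : ∀ g : G, p (s g) = g)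
    {M R : Type*} [AddCommGroup M] [DistribMulAction G M] [AddCommGroup R]
    (pair : M → p.ker → R) (μ : M) (ρ : G) : R :=
  ∑ σ : G, pair ((ρ * σ) • μ) (cocycleOf p s hs ρ σ)

/-- **Commutativity of the diagram relating the chain complex of `W` with
coefficients in `X` to the cochain complex of `G` with coefficients in
`T = X ⊗_ℤ C` via `φ` and `ψ`:** (i) `φ` vanishes on 2-boundaries, and (ii) `ψ`
intertwines the boundary of 1-chains with the coboundary of `φ`:
`ψ(∂₁x)(ρ) = ρ•φ(x) − φ(x)`.  Here `W` is a group, `C` its abelian normal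
subgroup realized as the kernel of a surjection `p` onto the finite group
`G = W/C`, `s` is a section of `p` with `s(1) = 1`, `X` is a `G`-module, and
`⟨·,·⟩ : X × C → T` is the canonical bilinear pairing into `T = X ⊗_ℤ C`,
equivariant for the diagonal `G`-action (the `G`-action on `C` being by
conjugation). -/
theorem phi_psi_commute_with_boundaries [Fintype G]
    {X T : Type*} [AddCommGroup X] [DistribMulAction G X]
    [AddCommGroup T] [DistribMulAction G T]
    (p : W →* G) (hp : Function.Surjective p)
    (hab : ∀ c c' : p.ker, c * c' = c' * c)
    (s : G → W) (hs : ∀ g : G, p (s g) = g) (hs1 : s 1 = 1)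
    (pair : X → p.ker → T)
    (hpair_addX : ∀ (x x' : X) (c : p.ker), pair (x + x') c = pair x c + pair x' c)
    (hpair_mulC : ∀ (x : X) (c c' : p.ker), pair x (c * c') = pair x c + pair x c')
    (hpair_smul : ∀ (w : W) (x : X) (c : p.ker),
      p w • pair x c = pair (p w • x) (kerConj p w c)) :
    (∀ y : (W × W) →₀ X, phiMap p s hs pair (d2 p y) = 0) ∧
    (∀ (x : W →₀ X) (ρ : G),
      psiMap p s hs pair (d1 p x) ρ
        = ρ • phiMap p s hs pair x - phiMap p s hs pair x) := by
  classical
  have hk : ∀ σ w, cocycleOf p s hs σ (p w) * kerConj p (s σ) (cPart p s hs w)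
      = (⟨s σ * w * (s (σ * p w))⁻¹, by simp [MonoidHom.mem_ker, hs]⟩ : p.ker) := by
    intro σ w
    rw [hab]
    apply Subtype.ext
    simp only [cocycleOf, kerConj, cPart, Subgroup.coe_mul]
    group
  obtain ⟨k, hkd⟩ : ∃ k : G → W → p.ker, ∀ σ w, (k σ w : W) = s σ * w * (s (σ * p w))⁻¹ :=
    ⟨fun σ w => ⟨s σ * w * (s (σ * p w))⁻¹, by simp [MonoidHom.mem_ker, hs]⟩, fun _ _ => rfl⟩
  have hk' : ∀ σ w, cocycleOf p s hs σ (p w) * kerConj p (s σ) (cPart p s hs w) = k σ w := by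
    intro σ w
    rw [hk]
    exact Subtype.ext (hkd σ w).symm
  have hk1 : ∀ σ w₁ w₂, k σ (w₁ * w₂) = k σ w₁ * k (σ * p w₁) w₂ := by
    intro σ w₁ w₂
    apply Subtype.ext
    simp only [hkd, Subgroup.coe_mul, map_mul, ← mul_assoc]
    group
  have hk2 : ∀ ρ σ w, kerConj p (s ρ) (k σ w) * cocycleOf p s hs ρ (σ * p w)
      = cocycleOf p s hs ρ σ * k (ρ * σ) w := by
    intro ρ σ w
    apply Subtype.ext
    simp only [hkd, kerConj, cocycleOf, Subgroup.coe_mul, ← mul_assoc]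
    group
  have h0 : ∀ c, pair 0 c = 0 := by
    intro c
    have := hpair_addX 0 0 c
    simpa using this
  have hphi : ∀ x, phiMap p s hs pair x
      = - ∑ σ : G, x.sum fun w v => pair (σ • v) (k σ w) := by
    intro x
    simp only [phiMap, hk']
  have hphi0 : phiMap p s hs pair 0 = 0 := by simp [hphi]
  have hphiadd : ∀ x x', phiMap p s hs pair (x + x')
      = phiMap p s hs pair x + phiMap p s hs pair x' := by
    intro x x'
    rw [hphi, hphi, hphi, ← neg_add, ← Finset.sum_add_distrib]
    congr 1
    refine Finset.sum_congr rfl fun σ _ => ?_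
    exact Finsupp.sum_add_index' (by simp [h0]) (by simp [hpair_addX, smul_add])
  have hphis : ∀ w v, phiMap p s hs pair (Finsupp.single w v)
      = - ∑ σ : G, pair (σ • v) (k σ w) := by
    intro w v
    rw [hphi]
    congr 1
    refine Finset.sum_congr rfl fun σ _ => ?_
    exact Finsupp.sum_single_index (by simp [h0])
  have hphisub : ∀ x x', phiMap p s hs pair (x - x')
      = phiMap p s hs pair x - phiMap p s hs pair x' := by
    intro x x'
    have := hphiadd (x - x') x'
    rw [sub_add_cancel] at this
    rw [this, add_sub_cancel_right]
  have hre : ∀ (τ : G) (f : G → T), ∑ σ, f (σ * τ) = ∑ σ, f σ := fun τ f =>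
    Equiv.sum_comp (Equiv.mulRight τ) f
  have hrel : ∀ (τ : G) (f : G → T), ∑ σ, f (τ * σ) = ∑ σ, f σ := fun τ f =>
    Equiv.sum_comp (Equiv.mulLeft τ) f
  constructor
  · intro y
    induction y using Finsupp.induction_linear with
    | zero => simp [d2, hphi0]
    | add y y' h h' =>
      have : d2 p (y + y') = d2 p y + d2 p y' := by
        simp only [d2]
        rw [Finsupp.sum_add_index' (by simp) (by simp),
          Finsupp.sum_add_index' (by simp) (by simp),
          Finsupp.sum_add_index' (by simp) (by simp)]
        abel
      rw [this, hphiadd, h, h', add_zero]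
    | single q v =>
      obtain ⟨w₁, w₂⟩ := q
      simp only [d2]
      rw [Finsupp.sum_single_index (by simp), Finsupp.sum_single_index (by simp),
        Finsupp.sum_single_index (by simp), hphiadd, hphisub, hphis, hphis, hphis,
        ← hre (p w₁) (fun σ => pair (σ • (p w₁)⁻¹ • v) (k σ w₂))]
      simp only [smul_smul, mul_inv_cancel_right, hk1, hpair_mulC, Finset.sum_add_distrib]
      abel
  · intro x ρ
    have hpsiadd : ∀ m m', psiMap p s hs pair (m + m') ρ
        = psiMap p s hs pair m ρ + psiMap p s hs pair m' ρ := by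
      intro m m'
      simp only [psiMap, smul_add, hpair_addX, Finset.sum_add_distrib]
    have hpsisub : ∀ m m', psiMap p s hs pair (m - m') ρ
        = psiMap p s hs pair m ρ - psiMap p s hs pair m' ρ := by
      intro m m'
      have := hpsiadd (m - m') m'
      rw [sub_add_cancel] at this
      rw [this, add_sub_cancel_right]
    induction x using Finsupp.induction_linear with
    | zero => simp [d1, hphi0, psiMap, h0]
    | add y y' h h' =>
      have : d1 p (y + y') = d1 p y + d1 p y' := by
        simp only [d1]
        exact Finsupp.sum_add_index' (by simp) (by intros; rw [smul_add]; abel)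
      rw [this, hpsiadd, h, h', hphiadd, smul_add]
      abel
    | single w v =>
      have hd : d1 p (Finsupp.single w v) = (p w)⁻¹ • v - v := by
        simp only [d1]
        exact Finsupp.sum_single_index (by simp)
      have hsm : ∀ m c, ρ • pair m c = pair (ρ • m) (kerConj p (s ρ) c) := by
        intro m c
        have := hpair_smul (s ρ) m c
        rwa [hs] at this
      rw [hd, hpsisub, hphis, smul_neg, Finset.smul_sum,
        ← hrel ρ (fun σ => pair (σ • v) (k σ w))]
      simp only [psiMap]
      rw [← hre (p w) (fun σ => pair ((ρ * σ) • (p w)⁻¹ • v) (cocycleOf p s hs ρ σ))]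
      simp only [smul_smul, ← mul_assoc, mul_inv_cancel_right, hsm]
      rw [sub_eq_iff_eq_add, sub_neg_eq_add, add_assoc, eq_neg_add_iff_add_eq,
        ← Finset.sum_add_distrib, ← Finset.sum_add_distrib]
      refine Finset.sum_congr rfl fun σ _ => ?_
      rw [← hpair_mulC, hk2, hpair_mulC, add_comm]

end Stmt0
end

section
/- The map on hyper(co)chains induced by the pair (ψ, φ) is independent of the chosen section up to an explicit 1-hypercoboundary: suppose s, s' are two sections of p with s(1) = s'(1) = 1, with associated 2-cocycles a, a' and associated maps ψ, φ (for s) and ψ', φ' (for s'), defined by the same formulas on both X-valued and Y-valued chains. Let x ∈ X satisfy Σ_{σ∈G} σ•x = 0 (x has norm zero) and let y : W → Y be finitely supported with f_*(x) = ∂₁y. Set t := Σ_{σ∈G} ⟨σ•x, s'(σ)·s(σ)⁻¹⟩ ∈ T (noting s'(σ)s(σ)⁻¹ ∈ C). Then for all ρ ∈ G one has ψ'(x)(ρ) − ψ(x)(ρ) = ρ•t − t, and moreover φ'(y) − φ(y) = f(t), where f := f_* ⊗ id_C : T → U. -/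
namespace Stmt2

variable {W G : Type*} [Group W] [Group G]

/-- Conjugation of an element of `C = ker p` by an element of `W`. -/
def kerConj (p : W →* G) (w : W) (c : p.ker) : p.ker :=
  ⟨w * c * w⁻¹, by
    have hc : p (c : W) = 1 := c.2
    simp [MonoidHom.mem_ker, hc]⟩

/-- The 2-cocycle `a(σ,τ)` attached to a set-theoretic section `s` of `p`,
determined by `s(σ)·s(τ) = a(σ,τ)·s(στ)`. -/
def cocycleOf (p : W →* G) (s : G → W) (hs : ∀ g : G, p (s g) = g) (σ τ : G) :
    p.ker :=
  ⟨s σ * s τ * (s (σ * τ))⁻¹, by simp [MonoidHom.mem_ker, hs, mul_assoc]⟩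

/-- The kernel part `c` of `w` in the decomposition `w = c · s (p w)`. -/
def cPart (p : W →* G) (s : G → W) (hs : ∀ g : G, p (s g) = g) (w : W) : p.ker :=
  ⟨w * (s (p w))⁻¹, by simp [MonoidHom.mem_ker, hs]⟩

/-- The element `s'(σ)·s(σ)⁻¹` of `C = ker p`, for two sections `s`, `s'`. -/
def sDiff (p : W →* G) (s s' : G → W) (hs : ∀ g : G, p (s g) = g)
    (hs' : ∀ g : G, p (s' g) = g) (σ : G) : p.ker :=
  ⟨s' σ * (s σ)⁻¹, by simp [MonoidHom.mem_ker, hs, hs']⟩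

/-- The boundary of a finitely supported 1-chain:
`∂₁x = Σ_w ((p w)⁻¹ • x w − x w)`. -/
def d1 (p : W →* G) {M : Type*} [AddCommGroup M] [DistribMulAction G M]
    (x : W →₀ M) : M :=
  x.sum fun w v => (p w)⁻¹ • v - v

/-- The map `φ` attached to a section `s` of `p`:
`φ(x) = −Σ_{σ,τ∈G} Σ_{c∈C} ⟨σ•x(c·s(τ)), a(σ,τ)·(σ•c)⟩`, reindexed by
`w = c·s(τ)`. -/
def phiMap (p : W →* G) [Fintype G] (s : G → W) (hs : ∀ g : G, p (s g) = g)
    {M R : Type*} [AddCommGroup M] [DistribMulAction G M] [AddCommGroup R]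
    (pair : M → p.ker → R) (x : W →₀ M) : R :=
  - ∑ σ : G, x.sum fun w v =>
      pair (σ • v) (cocycleOf p s hs σ (p w) * kerConj p (s σ) (cPart p s hs w))

/-- The map `ψ` attached to a section `s` of `p`:
`ψ(μ)(ρ) = Σ_{σ∈G} ⟨(ρσ)•μ, a(ρ,σ)⟩`. -/
def psiMap (p : W →* G) [Fintype G] (s : G → W) (hs : ∀ g : G, p (s g) = g)
    {M R : Type*} [AddCommGroup M] [DistribMulAction G M] [AddCommGroup R]
    (pair : M → p.ker → R) (μ : M) (ρ : G) : R :=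
  ∑ σ : G, pair ((ρ * σ) • μ) (cocycleOf p s hs ρ σ)

/-- **Independence of the hyper(co)chain map `(ψ, φ)` from the chosen section, up
to an explicit 1-hypercoboundary.**  For two sections `s`, `s'` of `p` with
`s(1) = s'(1) = 1`, a norm-zero `x ∈ X` and a finitely supported `y : W → Y` with
`f_*(x) = ∂₁y`, set `t := Σ_σ ⟨σ•x, s'(σ)·s(σ)⁻¹⟩ ∈ T = X ⊗_ℤ C`.  Then
`ψ'(x)(ρ) − ψ(x)(ρ) = ρ•t − t` for all `ρ ∈ G`, and `φ'(y) − φ(y) = f(t)`, where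
`f = f_* ⊗ id_C : T → U = Y ⊗_ℤ C`. -/
theorem section_change_is_hypercoboundary [Fintype G]
    {X Y T U : Type*}
    [AddCommGroup X] [DistribMulAction G X]
    [AddCommGroup Y] [DistribMulAction G Y]
    [AddCommGroup T] [DistribMulAction G T]
    [AddCommGroup U] [DistribMulAction G U]
    (p : W →* G) (hp : Function.Surjective p)
    (hab : ∀ c c' : p.ker, c * c' = c' * c)
    (s s' : G → W)
    (hs : ∀ g : G, p (s g) = g) (hs1 : s 1 = 1)
    (hs' : ∀ g : G, p (s' g) = g) (hs'1 : s' 1 = 1)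
    (fstar : X →+ Y) (hfstar : ∀ (g : G) (x : X), fstar (g • x) = g • fstar x)
    (pairX : X → p.ker → T)
    (hpairX_addX : ∀ (x x' : X) (c : p.ker),
      pairX (x + x') c = pairX x c + pairX x' c)
    (hpairX_mulC : ∀ (x : X) (c c' : p.ker),
      pairX x (c * c') = pairX x c + pairX x c')
    (hpairX_smul : ∀ (w : W) (x : X) (c : p.ker),
      p w • pairX x c = pairX (p w • x) (kerConj p w c))
    (pairY : Y → p.ker → U)
    (hpairY_addY : ∀ (y y' : Y) (c : p.ker),
      pairY (y + y') c = pairY y c + pairY y' c)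
    (hpairY_mulC : ∀ (y : Y) (c c' : p.ker),
      pairY y (c * c') = pairY y c + pairY y c')
    (hpairY_smul : ∀ (w : W) (y : Y) (c : p.ker),
      p w • pairY y c = pairY (p w • y) (kerConj p w c))
    (fT : T →+ U)
    (hfT : ∀ (x : X) (c : p.ker), fT (pairX x c) = pairY (fstar x) c)
    (hfT_smul : ∀ (g : G) (t : T), fT (g • t) = g • fT t)
    (x : X) (hx : ∑ σ : G, σ • x = 0)
    (y : W →₀ Y) (hxy : fstar x = d1 p y) :
    (∀ ρ : G,
      psiMap p s' hs' pairX x ρ - psiMap p s hs pairX x ρ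
        = ρ • (∑ σ : G, pairX (σ • x) (sDiff p s s' hs hs' σ))
          - ∑ σ : G, pairX (σ • x) (sDiff p s s' hs hs' σ)) ∧
    phiMap p s' hs' pairY y - phiMap p s hs pairY y
      = fT (∑ σ : G, pairX (σ • x) (sDiff p s s' hs hs' σ)) := by
  classical
  refine ⟨fun ρ => ?_, ?_⟩
  · have key : ∀ σ : G, pairX ((ρ * σ) • x) (cocycleOf p s' hs' ρ σ)
        + pairX ((ρ * σ) • x) (sDiff p s s' hs hs' (ρ * σ))
        = pairX ((ρ * σ) • x) (sDiff p s s' hs hs' ρ)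
        + ρ • pairX (σ • x) (sDiff p s s' hs hs' σ)
        + pairX ((ρ * σ) • x) (cocycleOf p s hs ρ σ) := by
      intro σ
      have h1 := hpairX_smul (s ρ) (σ • x) (sDiff p s s' hs hs' σ)
      rw [hs, smul_smul] at h1
      rw [h1, ← hpairX_mulC, ← hpairX_mulC, ← hpairX_mulC]
      congr 1
      apply Subtype.ext
      simp only [cocycleOf, sDiff, kerConj, Subgroup.coe_mul]
      group
    have hsum := Finset.sum_congr (rfl : (Finset.univ : Finset G) = Finset.univ)
      (fun σ _ => key σ)
    simp only [Finset.sum_add_distrib] at hsum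
    have h0 : ∑ σ : G, pairX ((ρ * σ) • x) (sDiff p s s' hs hs' ρ) = 0 := by
      rw [Fintype.sum_equiv (Equiv.mulLeft ρ)
        (fun σ => pairX ((ρ * σ) • x) (sDiff p s s' hs hs' ρ))
        (fun σ => pairX (σ • x) (sDiff p s s' hs hs' ρ)) (fun _ => rfl)]
      have := map_sum (AddMonoidHom.mk' (fun v => pairX v (sDiff p s s' hs hs' ρ))
        (fun a b => hpairX_addX a b _)) (fun σ : G => σ • x) Finset.univ
      rw [hx, map_zero] at this
      exact this.symm
    have h2 : ∑ σ : G, pairX ((ρ * σ) • x) (sDiff p s s' hs hs' (ρ * σ))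
        = ∑ σ : G, pairX (σ • x) (sDiff p s s' hs hs' σ) :=
      Fintype.sum_equiv (Equiv.mulLeft ρ) _ _ (fun _ => rfl)
    rw [h0, h2, zero_add, ← Finset.smul_sum] at hsum
    unfold psiMap
    rw [sub_eq_sub_iff_add_eq_add, hsum]
  · have hB : ∀ (r : G → W) (hr : ∀ g : G, p (r g) = g) (σ : G) (w : W),
        ((cocycleOf p r hr σ (p w) * kerConj p (r σ) (cPart p r hr w) : p.ker) : W)
          = r σ * w * (r (σ * p w))⁻¹ := by
      intro r hr σ w
      rw [hab]
      simp only [cocycleOf, cPart, kerConj, Subgroup.coe_mul]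
      group
    have key : ∀ (σ : G) (w : W) (v : Y),
        pairY v (cocycleOf p s' hs' σ (p w) * kerConj p (s' σ) (cPart p s' hs' w))
          + pairY v (sDiff p s s' hs hs' (σ * p w))
        = pairY v (sDiff p s s' hs hs' σ)
          + pairY v (cocycleOf p s hs σ (p w) * kerConj p (s σ) (cPart p s hs w)) := by
      intro σ w v
      rw [← hpairY_mulC, ← hpairY_mulC v (sDiff p s s' hs hs' σ)]
      congr 1
      apply Subtype.ext
      rw [Subgroup.coe_mul, Subgroup.coe_mul (H := p.ker) (sDiff p s s' hs hs' σ), hB, hB]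
      simp only [sDiff]
      group
    let P : p.ker → (Y →+ U) := fun c =>
      AddMonoidHom.mk' (fun v => pairY v c) (fun a b => hpairY_addY a b c)
    have hP : ∀ c v, pairY v c = P c v := fun _ _ => rfl
    have hR : fT (∑ σ : G, pairX (σ • x) (sDiff p s s' hs hs' σ))
        = ∑ w ∈ y.support, ∑ σ : G,
          (pairY (σ • y w) (sDiff p s s' hs hs' (σ * p w))
            - pairY (σ • y w) (sDiff p s s' hs hs' σ)) := by
      have : ∀ w : W, ∑ σ : G, pairY (σ • y w) (sDiff p s s' hs hs' (σ * p w))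
          = ∑ σ : G, pairY (σ • (p w)⁻¹ • y w) (sDiff p s s' hs hs' σ) := fun w =>
        Fintype.sum_equiv (Equiv.mulRight (p w)) _ _ (fun σ => by
          simp [smul_smul])
      simp only [Finset.sum_sub_distrib, this]
      rw [map_sum]
      simp only [hfT, hfstar, hxy, d1, Finsupp.sum, Finset.smul_sum, hP, map_sum, smul_sub,
        map_sub]
      rw [Finset.sum_comm]
      simp only [Finset.sum_sub_distrib]
    rw [hR]
    simp only [phiMap, Finsupp.sum]
    rw [Finset.sum_comm, Finset.sum_comm (s := (Finset.univ : Finset G)), neg_sub_neg,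
      ← Finset.sum_sub_distrib]
    refine Finset.sum_congr rfl fun w _ => ?_
    rw [← Finset.sum_sub_distrib]
    refine Finset.sum_congr rfl fun σ _ => ?_
    rw [sub_eq_sub_iff_add_eq_add, add_comm, ← key σ w (σ • y w), add_comm]

end Stmt2
end

section
/- The Tate–Nakayama pairing between a pushforward along g and a pushforward along the dual of f vanishes; at the level of chains: let λ ∈ X and let μ : W → Y be a finitely supported function with f(λ) = Σ_{w∈W} (w⁻¹•μ(w) − μ(w)). Let s : Y → ℂˣ be a group homomorphism and let φ : W → Hom(V, ℂˣ) be a function satisfying φ(w)(g(y)) = s(y)⁻¹·s(w⁻¹•y) for all w ∈ W and y ∈ Y. Then s(f(λ)) · Π_{w∈W} φ(w)(g(μ(w)))⁻¹ = 1 (the product being over the finite support of μ). -/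
/-- **Vanishing of the Tate–Nakayama pairing on pushforwards (chain level).**
`W` is a group, `X`, `Y`, `V` are `W`-modules, `f : X → Y` and `g : Y → V` are
`W`-equivariant homomorphisms.  Given `λ ∈ X` and a finitely supported
`μ : W → Y` with `f λ = Σ_w (w⁻¹•μ(w) − μ(w))`, a homomorphism `s : Y → ℂˣ` and a
function `φ : W → Hom(V, ℂˣ)` with `φ(w)(g y) = s(y)⁻¹ · s(w⁻¹•y)`, one has
`s(f λ) · Π_w φ(w)(g(μ(w)))⁻¹ = 1`. -/
theorem pairing_of_pushforwards_vanishes {W X Y V : Type*} [Group W]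
    [AddCommGroup X] [AddCommGroup Y] [AddCommGroup V]
    [DistribMulAction W X] [DistribMulAction W Y] [DistribMulAction W V]
    (f : X →+ Y) (g : Y →+ V)
    (hf : ∀ (w : W) (x : X), f (w • x) = w • f x)
    (hg : ∀ (w : W) (y : Y), g (w • y) = w • g y)
    (lam : X) (μ : W →₀ Y)
    (hμ : f lam = μ.sum fun w v => w⁻¹ • v - v)
    (s : Y → ℂˣ) (hs : ∀ y y' : Y, s (y + y') = s y * s y')
    (φ : W → V → ℂˣ)
    (hφhom : ∀ (w : W) (v v' : V), φ w (v + v') = φ w v * φ w v')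
    (hφ : ∀ (w : W) (y : Y), φ w (g y) = (s y)⁻¹ * s (w⁻¹ • y)) :
    s (f lam) * μ.prod (fun w v => (φ w (g v))⁻¹) = 1 := by
  have h0 : s 0 = 1 := by
    have h := hs 0 0
    rw [add_zero] at h
    exact (left_eq_mul.mp h)
  have hsub : ∀ a b : Y, s (a - b) = (s b)⁻¹ * s a := by
    intro a b
    have h := hs (a - b) b
    rw [sub_add_cancel] at h
    rw [h, mul_comm (s (a - b)), inv_mul_cancel_left]
  have hsum : ∀ (t : Finset W) (F : W → Y), s (∑ w ∈ t, F w) = ∏ w ∈ t, s (F w) := by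
    intro t F
    classical
    induction t using Finset.induction_on with
    | empty => simpa using h0
    | insert a t ha ih => rw [Finset.sum_insert ha, Finset.prod_insert ha, hs, ih]
  rw [hμ, Finsupp.sum, Finsupp.prod, hsum, ← Finset.prod_mul_distrib]
  apply Finset.prod_eq_one
  intro w _
  rw [hsub, hφ, mul_inv_cancel]
end

section
/- The norm-zero modified zeroth hyperhomology of a two-term complex fits into an exact sequence: with f_* : H₁(W,X) → H₁(W,Y) induced by f, ι : H₁(W,Y) → H₀(W, X→Y)₀ given by [y] ↦ [(0,y)], π : H₀(W, X→Y)₀ → H₀(W,X)₀ given by [(x,y)] ↦ [x], and f̄ : H₀(W,X)₀ → H₀(W,Y)₀ induced by f, the sequence H₁(W,X) → H₁(W,Y) → H₀(W, X→Y)₀ → H₀(W,X)₀ → H₀(W,Y)₀ is exact at H₁(W,Y), at H₀(W, X→Y)₀, and at H₀(W,X)₀. -/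
namespace Stmt5

variable {W G : Type*} [Group W] [Group G]

/-- The boundary of a finitely supported 1-chain of `W` with coefficients in a
`G`-module `M` (the `W`-action being via `p`): `∂₁x = Σ_w ((p w)⁻¹ • x w − x w)`. -/
def d1 (p : W →* G) {M : Type*} [AddCommGroup M] [DistribMulAction G M]
    (x : W →₀ M) : M :=
  x.sum fun w v => (p w)⁻¹ • v - v

/-- The boundary of a finitely supported 2-chain:
`(∂₂y)(w) = Σ_{w₁} (p w₁)⁻¹ • y(w₁,w) − Σ_{w₁w₂=w} y(w₁,w₂) + Σ_{w₂} y(w,w₂)`. -/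
noncomputable def d2 (p : W →* G) {M : Type*} [AddCommGroup M] [DistribMulAction G M]
    (y : (W × W) →₀ M) : W →₀ M :=
  (y.sum fun q v => Finsupp.single q.2 ((p q.1)⁻¹ • v))
    - (y.sum fun q v => Finsupp.single (q.1 * q.2) v)
    + (y.sum fun q v => Finsupp.single q.1 v)

theorem d1_add (p : W →* G) {M : Type*} [AddCommGroup M] [DistribMulAction G M]
    (x y : W →₀ M) : d1 p (x + y) = d1 p x + d1 p y := by
  unfold d1
  refine Finsupp.sum_add_index' (fun w => by simp) (fun w a b => ?_)
  rw [smul_add]; abel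

theorem d1_sub (p : W →* G) {M : Type*} [AddCommGroup M] [DistribMulAction G M]
    (x y : W →₀ M) : d1 p (x - y) = d1 p x - d1 p y := by
  have h := d1_add p (x - y) y
  rw [sub_add_cancel] at h
  rw [h, add_sub_cancel_right]

theorem d1_zero (p : W →* G) {M : Type*} [AddCommGroup M] [DistribMulAction G M] :
    d1 p (0 : W →₀ M) = 0 := Finsupp.sum_zero_index

theorem d2_zero (p : W →* G) {M : Type*} [AddCommGroup M] [DistribMulAction G M] :
    d2 p (0 : (W × W) →₀ M) = 0 := by
  simp [d2]

theorem d2_add (p : W →* G) {M : Type*} [AddCommGroup M] [DistribMulAction G M]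
    (x y : (W × W) →₀ M) : d2 p (x + y) = d2 p x + d2 p y := by
  unfold d2
  rw [Finsupp.sum_add_index' (by simp) (by simp), Finsupp.sum_add_index' (by simp) (by simp),
    Finsupp.sum_add_index' (by simp) (by simp)]
  abel

theorem d2_neg (p : W →* G) {M : Type*} [AddCommGroup M] [DistribMulAction G M]
    (y : (W × W) →₀ M) : d2 p (-y) = - d2 p y := by
  have h := d2_add p (-y) y
  rw [neg_add_cancel, d2_zero] at h
  exact eq_neg_of_add_eq_zero_left h.symm

theorem d1_mapRange (p : W →* G) {X Y : Type*} [AddCommGroup X] [AddCommGroup Y]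
    [DistribMulAction G X] [DistribMulAction G Y]
    (f : X →+ Y) (hf : ∀ (g : G) (x : X), f (g • x) = g • f x) (x : W →₀ X) :
    d1 p (Finsupp.mapRange f (map_zero f) x) = f (d1 p x) := by
  unfold d1
  rw [Finsupp.sum_mapRange_index (by simp), map_finsuppSum]
  simp [hf]

/-- **Exactness of the norm-zero modified hyperhomology sequence**
`H₁(W,X) → H₁(W,Y) → H₀(W, X→Y)₀ → H₀(W,X)₀ → H₀(W,Y)₀`, stated explicitly at the
level of chains.  Here `W` is a group, `G = W/C` is finite (encoded by a surjective
homomorphism `p : W →* G`), `X`, `Y` are `G`-modules regarded as `W`-modules via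
`p`, and `f : X → Y` is `G`-equivariant.  The three conjuncts express exactness at
`H₁(W,Y)`, at `H₀(W, X→Y)₀` and at `H₀(W,X)₀` respectively. -/
theorem norm_zero_hyperhomology_exactness [Fintype G]
    (p : W →* G) (hp : Function.Surjective p)
    {X Y : Type*} [AddCommGroup X] [AddCommGroup Y]
    [DistribMulAction G X] [DistribMulAction G Y]
    (f : X →+ Y) (hf : ∀ (g : G) (x : X), f (g • x) = g • f x) :
    -- exactness at `H₁(W,Y)`: `ker ι = im f_*`
    (∀ y : W →₀ Y, d1 p y = 0 →
      ((∃ (x' : W →₀ X) (y' : (W × W) →₀ Y),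
          d1 p x' = 0 ∧ y = Finsupp.mapRange f (map_zero f) x' - d2 p y') ↔
        ∃ (x : W →₀ X) (y'' : (W × W) →₀ Y),
          d1 p x = 0 ∧ y = Finsupp.mapRange f (map_zero f) x + d2 p y'')) ∧
    -- exactness at `H₀(W, X→Y)₀`: `ker π = im ι`
    (∀ (x : X) (y : W →₀ Y), (∑ σ : G, σ • x = 0) → f x = d1 p y →
      ((∃ x' : W →₀ X, x = d1 p x') ↔
        ∃ (yt : W →₀ Y) (x' : W →₀ X) (y' : (W × W) →₀ Y),
          d1 p yt = 0 ∧ x = d1 p x' ∧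
            y - yt = Finsupp.mapRange f (map_zero f) x' - d2 p y')) ∧
    -- exactness at `H₀(W,X)₀`: `ker f̄ = im π`
    (∀ x : X, (∑ σ : G, σ • x = 0) →
      ((∃ y : W →₀ Y, f x = d1 p y) ↔
        ∃ (xt : X) (y : W →₀ Y) (x' : W →₀ X),
          (∑ σ : G, σ • xt = 0) ∧ f xt = d1 p y ∧ x = xt + d1 p x')) := by
  refine ⟨fun y _ => ⟨?_, ?_⟩, fun x y _ hxy => ⟨?_, ?_⟩, fun x hx => ⟨?_, ?_⟩⟩
  · rintro ⟨x', y', h1, h2⟩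
    exact ⟨x', -y', h1, by rw [d2_neg, h2, sub_eq_add_neg]⟩
  · rintro ⟨x', y', h1, h2⟩
    exact ⟨x', -y', h1, by rw [d2_neg, h2, sub_neg_eq_add]⟩
  · rintro ⟨x', h⟩
    refine ⟨y - Finsupp.mapRange f (map_zero f) x', x', 0, ?_, h, ?_⟩
    · rw [d1_sub, d1_mapRange p f hf, ← h, hxy, sub_self]
    · rw [d2_zero, sub_zero, sub_sub_cancel]
  · rintro ⟨_, x', _, _, h, _⟩
    exact ⟨x', h⟩
  · rintro ⟨y, h⟩
    exact ⟨x, y, 0, hx, h, by rw [d1_zero, add_zero]⟩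
  · rintro ⟨xt, y, x', _, h, h'⟩
    exact ⟨y + Finsupp.mapRange f (map_zero f) x', by
      rw [h', map_add, d1_add, d1_mapRange p f hf, h]⟩

end Stmt5
end

section
/- The Kottwitz–Shelstad pairing between 0-hypercycles and 1-hypercocycles descends to (co)homology classes: the value P((x,y),(u,t)) := t(x) · Π_{w∈W} u(w)(y(w))⁻¹ is unchanged (a) if (x,y) is replaced by (x + ∂₁x', y + f∘x' − ∂₂y') for any finitely supported x' : W → X and y' : W × W → Y, and (b) if (u,t) is replaced by (u·∂û, t·(û∘f)) for any group homomorphism û : Y → ℂˣ, where (∂û)(w) := û⁻¹·(w•û). -/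
namespace Stmt6

variable {W : Type*} [Group W]

/-- The boundary of a finitely supported 1-chain of `W` with coefficients in a
`W`-module `M`: `∂₁x = Σ_w (w⁻¹ • x w − x w)`. -/
def d1 {M : Type*} [AddCommGroup M] [DistribMulAction W M] (x : W →₀ M) : M :=
  x.sum fun w v => w⁻¹ • v - v

/-- The boundary of a finitely supported 2-chain:
`(∂₂y)(w) = Σ_{w₁} w₁⁻¹ • y(w₁,w) − Σ_{w₁w₂=w} y(w₁,w₂) + Σ_{w₂} y(w,w₂)`. -/
noncomputable def d2 {M : Type*} [AddCommGroup M] [DistribMulAction W M]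
    (y : (W × W) →₀ M) : W →₀ M :=
  (y.sum fun q v => Finsupp.single q.2 (q.1⁻¹ • v))
    - (y.sum fun q v => Finsupp.single (q.1 * q.2) v)
    + (y.sum fun q v => Finsupp.single q.1 v)

/-- **The Kottwitz–Shelstad pairing between 0-hypercycles and 1-hypercocycles
descends to (co)homology classes.**  `W` is a group, `X`, `Y` are `W`-modules and
`f : X → Y` is `W`-equivariant; `(x,y)` is a 0-hypercycle, `(u,t)` a
1-hypercocycle, and `P((x,y),(u,t)) = t(x) · Π_w u(w)(y(w))⁻¹`.  The value `P` is
unchanged if (a) `(x,y)` is replaced by `(x + ∂₁x', y + f∘x' − ∂₂y')`, or (b)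
`(u,t)` is replaced by `(u·∂û, t·(û∘f))` for a homomorphism `û : Y → ℂˣ`, where
`(∂û)(w) = û⁻¹·(w•û)` and `(w•û)(m) = û(w⁻¹•m)`. -/
theorem pairing_descends_to_classes {X Y : Type*}
    [AddCommGroup X] [AddCommGroup Y]
    [DistribMulAction W X] [DistribMulAction W Y]
    (f : X →+ Y) (hf : ∀ (w : W) (x : X), f (w • x) = w • f x)
    (x : X) (y : W →₀ Y)
    (hxy : f x = d1 y)
    (u : W → Y → ℂˣ)
    (hu_hom : ∀ (w : W) (y₁ y₂ : Y), u w (y₁ + y₂) = u w y₁ * u w y₂)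
    (hu_cocycle : ∀ (w₁ w₂ : W) (m : Y), u (w₁ * w₂) m = u w₁ m * u w₂ (w₁⁻¹ • m))
    (t : X → ℂˣ) (ht_hom : ∀ x₁ x₂ : X, t (x₁ + x₂) = t x₁ * t x₂)
    (hut : ∀ (w : W) (x' : X), u w (f x') = (t x')⁻¹ * t (w⁻¹ • x')) :
    -- (a) invariance under changing the 0-hypercycle by a hyperboundary
    (∀ (x' : W →₀ X) (y' : (W × W) →₀ Y),
      t (x + d1 x') *
          (y + Finsupp.mapRange f (map_zero f) x' - d2 y').prod
            (fun w v => (u w v)⁻¹)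
        = t x * y.prod fun w v => (u w v)⁻¹) ∧
    -- (b) invariance under changing the 1-hypercocycle by a hypercoboundary
    (∀ uhat : Y → ℂˣ, (∀ y₁ y₂ : Y, uhat (y₁ + y₂) = uhat y₁ * uhat y₂) →
      (t x * uhat (f x)) *
          y.prod (fun w v => (u w v * (uhat v)⁻¹ * uhat (w⁻¹ • v))⁻¹)
        = t x * y.prod fun w v => (u w v)⁻¹) := by
  have hu0 : ∀ w, u w 0 = 1 := fun w => by
    have h := hu_hom w 0 0
    rw [add_zero] at h
    exact left_eq_mul.mp h
  have ht0 : t 0 = 1 := by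
    have h := ht_hom 0 0
    rw [add_zero] at h
    exact left_eq_mul.mp h
  refine ⟨?_, ?_⟩
  · intro x' y'
    obtain ⟨P, hP⟩ : ∃ P : (W →₀ Y) → ℂˣ, P = fun z => z.prod (fun w v => (u w v)⁻¹) := ⟨_, rfl⟩
    have hPadd : ∀ a b, P (a + b) = P a * P b := by
      intro a b
      rw [hP]
      exact Finsupp.prod_add_index' (fun w => by simp [hu0])
        (fun w a b => by rw [hu_hom, mul_inv])
    have hP0 : P 0 = 1 := by simp [hP]
    have hPs : ∀ w v, P (Finsupp.single w v) = (u w v)⁻¹ := by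
      intro w v
      rw [hP]
      exact Finsupp.prod_single_index (by simp [hu0])
    have hPsub : ∀ a b, P (a - b) = P a * (P b)⁻¹ := by
      intro a b
      rw [eq_mul_inv_iff_mul_eq, ← hPadd, sub_add_cancel]
    have hd2add : ∀ a b : (W × W) →₀ Y, d2 (a + b) = d2 a + d2 b := by
      intro a b
      unfold d2
      rw [Finsupp.sum_add_index' (by simp) (by simp), Finsupp.sum_add_index' (by simp) (by simp),
        Finsupp.sum_add_index' (by simp) (by simp)]
      abel
    have hd2 : ∀ a : (W × W) →₀ Y, P (d2 a) = 1 := by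
      intro a
      induction a using Finsupp.induction_linear with
      | zero => simp [d2, hP0]
      | add a b ha hb => rw [hd2add, hPadd, ha, hb, mul_one]
      | single q v =>
        unfold d2
        rw [Finsupp.sum_single_index (by simp), Finsupp.sum_single_index (by simp),
          Finsupp.sum_single_index (by simp), hPadd, hPsub, hPs, hPs, hPs, hu_cocycle]
        simp
    have hd1 : ∀ a : W →₀ X, t (d1 a) * P (Finsupp.mapRange f (map_zero f) a) = 1 := by
      intro a
      induction a using Finsupp.induction_linear with
      | zero => simp [d1, hP0, ht0]
      | add a b ha hb =>
        have : d1 (a + b) = d1 a + d1 b := by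
          unfold d1
          rw [Finsupp.sum_add_index' (by simp) (by intros; rw [smul_add]; abel)]
        rw [this, ht_hom, Finsupp.mapRange_add (map_add f), hPadd, mul_mul_mul_comm, ha, hb,
          mul_one]
      | single w v =>
        have h1 : d1 (Finsupp.single w v) = w⁻¹ • v - v := by
          unfold d1
          rw [Finsupp.sum_single_index (by simp)]
        have h2 : t (w⁻¹ • v - v) = (t v)⁻¹ * t (w⁻¹ • v) := by
          rw [eq_inv_mul_iff_mul_eq, ← ht_hom, add_sub_cancel]
        rw [h1, Finsupp.mapRange_single, hPs, hut, h2, mul_inv_cancel]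
    have key : t (x + d1 x') * P (y + Finsupp.mapRange f (map_zero f) x' - d2 y') = t x * P y := by
      rw [hPsub, hd2, hPadd, ht_hom, inv_one, mul_one, mul_mul_mul_comm, hd1, mul_one]
    rw [hP] at key
    exact key
  · intro uhat hh
    have h0 : uhat 0 = 1 := by
      have h := hh 0 0
      rw [add_zero] at h
      exact left_eq_mul.mp h
    have hsub : ∀ a b, uhat (a - b) = uhat a * (uhat b)⁻¹ := by
      intro a b
      rw [eq_mul_inv_iff_mul_eq, ← hh, sub_add_cancel]
    have hsum : ∀ (s : Finset W) (g : W → Y), uhat (∑ w ∈ s, g w) = ∏ w ∈ s, uhat (g w) := by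
      intro s g
      classical
      induction s using Finset.induction_on with
      | empty => simp [h0]
      | insert a s ha ih => rw [Finset.sum_insert ha, Finset.prod_insert ha, hh, ih]
    rw [hxy, mul_assoc]
    congr 1
    unfold d1 Finsupp.sum Finsupp.prod
    rw [hsum, ← Finset.prod_mul_distrib]
    refine Finset.prod_congr rfl fun w _ => ?_
    beta_reduce
    rw [hsub, mul_assoc (u w (y w)), mul_comm (uhat (y w))⁻¹, mul_inv (u w (y w)),
      mul_left_comm, mul_inv_cancel, mul_one]

end Stmt6
end

section
/- Cup product with a normalized 2-cocycle agrees with the map ψ up to the coboundary of an explicit element: for every μ ∈ X, setting β := Σ_{σ∈G} ⟨σ•μ, a(σ,σ⁻¹)⟩ ∈ T, one has for all ρ ∈ G the identity Σ_{σ∈G} ⟨σ•μ, σ•a(σ⁻¹,ρ)⟩ + (ρ•β − β) = Σ_{σ∈G} ⟨(ρσ)•μ, a(ρ,σ)⟩. -/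
/-- **Cup product with a normalized 2-cocycle agrees with `ψ` up to an explicit
coboundary.**  `G` is a finite group, `C` a multiplicative abelian group with a
`G`-action by automorphisms, `a : G × G → C` a normalized 2-cocycle, `X` a
`G`-module, and `⟨·,·⟩ : X × C → T` the canonical bilinear `G`-equivariant pairing
into `T = X ⊗_ℤ C`.  For every `μ ∈ X`, setting `β := Σ_σ ⟨σ•μ, a(σ,σ⁻¹)⟩`, one has
for all `ρ ∈ G`:
`Σ_σ ⟨σ•μ, σ•a(σ⁻¹,ρ)⟩ + (ρ•β − β) = Σ_σ ⟨(ρσ)•μ, a(ρ,σ)⟩`. -/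
theorem cup_product_eq_psi_up_to_coboundary {G C X T : Type*} [Group G] [Fintype G]
    [CommGroup C] [MulDistribMulAction G C]
    [AddCommGroup X] [DistribMulAction G X]
    [AddCommGroup T] [DistribMulAction G T]
    (a : G → G → C)
    (ha_left : ∀ σ : G, a 1 σ = 1) (ha_right : ∀ σ : G, a σ 1 = 1)
    (ha_cocycle : ∀ ρ σ τ : G, (ρ • a σ τ) * a ρ (σ * τ) = a (ρ * σ) τ * a ρ σ)
    (pair : X → C → T)
    (hpair_addX : ∀ (x x' : X) (c : C), pair (x + x') c = pair x c + pair x' c)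
    (hpair_mulC : ∀ (x : X) (c c' : C), pair x (c * c') = pair x c + pair x c')
    (hpair_smul : ∀ (g : G) (x : X) (c : C), g • pair x c = pair (g • x) (g • c))
    (μ : X) (ρ : G) :
    (∑ σ : G, pair (σ • μ) (σ • a σ⁻¹ ρ))
      + (ρ • (∑ σ : G, pair (σ • μ) (a σ σ⁻¹)) - ∑ σ : G, pair (σ • μ) (a σ σ⁻¹))
      = ∑ σ : G, pair ((ρ * σ) • μ) (a ρ σ) := by
  have h1 : ∑ σ : G, pair (σ • μ) (σ • a σ⁻¹ ρ) + ∑ σ : G, pair (σ • μ) (a σ (σ⁻¹ * ρ))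
      = ∑ σ : G, pair (σ • μ) (a σ σ⁻¹) := by
    rw [← Finset.sum_add_distrib]
    refine Finset.sum_congr rfl fun σ _ => ?_
    rw [← hpair_mulC, ha_cocycle, mul_inv_cancel, ha_left, one_mul]
  have h2 : ∑ σ : G, pair (σ • μ) (a σ (σ⁻¹ * ρ))
      = ∑ σ : G, pair ((ρ * σ) • μ) (a (ρ * σ) σ⁻¹) := by
    rw [← Equiv.sum_comp (Equiv.mulLeft ρ)]
    refine Finset.sum_congr rfl fun σ _ => ?_
    simp [mul_assoc]
  have h3 : ρ • (∑ σ : G, pair (σ • μ) (a σ σ⁻¹))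
      = ∑ σ : G, pair ((ρ * σ) • μ) (a (ρ * σ) σ⁻¹) + ∑ σ : G, pair ((ρ * σ) • μ) (a ρ σ) := by
    rw [Finset.smul_sum, ← Finset.sum_add_distrib]
    refine Finset.sum_congr rfl fun σ _ => ?_
    rw [← hpair_mulC, ← ha_cocycle, mul_inv_cancel, ha_right, mul_one, hpair_smul, mul_smul]
  rw [h3, ← h1, h2]
  abel
end

section
/- Induction from the stabilizer of a character gives a bijection on irreducible representations containing that character: (i) if (ρ,V) is a finite-dimensional irreducible representation of H containing χ, then Ind_H^G ρ is an irreducible representation of G containing χ; (ii) every finite-dimensional irreducible complex representation of G containing χ is isomorphic to Ind_H^G ρ for some finite-dimensional irreducible representation ρ of H containing χ; (iii) if ρ₁ and ρ₂ are finite-dimensional irreducible representations of H containing χ and Ind_H^G ρ₁ ≅ Ind_H^G ρ₂ as representations of G, then ρ₁ ≅ ρ₂. -/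
namespace Stmt9

variable {G : Type*} [Group G]

/-- The carrier of the representation of `G` induced from a representation
`(ρ, V)` of a subgroup `H`: functions `f : G → V` with `f(hg) = ρ(h) f(g)`. -/
def IndCarrier (H : Subgroup G) {V : Type*} [AddCommGroup V] [Module ℂ V]
    (ρ : Representation ℂ H V) : Submodule ℂ (G → V) where
  carrier := {f | ∀ (h : H) (g : G), f ((h : G) * g) = ρ h (f g)}
  add_mem' := by
    intro f₁ f₂ hf₁ hf₂ h g
    simp only [Pi.add_apply, hf₁ h g, hf₂ h g, map_add]
  zero_mem' := by
    intro h g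
    simp
  smul_mem' := by
    intro c f hf h g
    simp only [Pi.smul_apply, hf h g, map_smul]

/-- The representation of `G` induced from a representation `(ρ, V)` of a
subgroup `H`, with action `(g₀ • f)(g) = f(g·g₀)`. -/
def indRep (H : Subgroup G) {V : Type*} [AddCommGroup V] [Module ℂ V]
    (ρ : Representation ℂ H V) : Representation ℂ G (IndCarrier H ρ) where
  toFun g₀ :=
    { toFun := fun f =>
        ⟨fun g => (f : G → V) (g * g₀), by
          intro h g
          simpa [mul_assoc] using f.2 h (g * g₀)⟩
      map_add' := by intro f₁ f₂; apply Subtype.ext; rfl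
      map_smul' := by intro c f; apply Subtype.ext; rfl }
  map_one' := by
    apply LinearMap.ext; intro f
    apply Subtype.ext
    funext g
    show (f : G → V) (g * 1) = (f : G → V) g
    rw [mul_one]
  map_mul' := by
    intro a b
    apply LinearMap.ext; intro f
    apply Subtype.ext
    funext g
    show (f : G → V) (g * (a * b)) = (f : G → V) (g * a * b)
    rw [mul_assoc]

/-- A representation `(π, U)` of a subgroup `K ⊇ N` contains the character `χ` of
`N` if some nonzero vector transforms under `N` through `χ`. -/
def ContainsChi (N : Subgroup G) (χ : N →* ℂˣ) {K : Subgroup G} (hNK : N ≤ K)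
    {U : Type*} [AddCommGroup U] [Module ℂ U] (π : Representation ℂ K U) : Prop :=
  ∃ u : U, u ≠ 0 ∧ ∀ (n : G) (hn : n ∈ N),
    π ⟨n, hNK hn⟩ u = ((χ ⟨n, hn⟩ : ℂˣ) : ℂ) • u

/-- A representation `(π, U)` of `G` contains the character `χ` of `N` if some
nonzero vector transforms under `N` through `χ`. -/
def ContainsChiG (N : Subgroup G) (χ : N →* ℂˣ)
    {U : Type*} [AddCommGroup U] [Module ℂ U] (π : Representation ℂ G U) : Prop :=
  ∃ u : U, u ≠ 0 ∧ ∀ (n : G) (hn : n ∈ N),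
    π n u = ((χ ⟨n, hn⟩ : ℂˣ) : ℂ) • u

/-- Irreducibility of a representation: the space is nonzero and has no proper
nonzero invariant subspace. -/
def IsIrreducibleRep {K : Type*} [Group K] {U : Type*} [AddCommGroup U]
    [Module ℂ U] (π : Representation ℂ K U) : Prop :=
  (∃ u : U, u ≠ 0) ∧
    ∀ q : Submodule ℂ U, (∀ k : K, ∀ u ∈ q, π k u ∈ q) → q = ⊥ ∨ q = ⊤

/-- Isomorphism of two representations of a group `K`. -/
def RepIso {K : Type*} [Group K] {U₁ U₂ : Type*} [AddCommGroup U₁] [Module ℂ U₁]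
    [AddCommGroup U₂] [Module ℂ U₂]
    (π₁ : Representation ℂ K U₁) (π₂ : Representation ℂ K U₂) : Prop :=
  ∃ e : U₁ ≃ₗ[ℂ] U₂, ∀ (k : K) (u : U₁), e (π₁ k u) = π₂ k (e u)

/-- Extension by zero of a vector to a function supported on `H`. -/
noncomputable def extZ (H : Subgroup G) {V : Type*} [AddCommGroup V] [Module ℂ V]
    (ρ : Representation ℂ H V) : V →ₗ[ℂ] IndCarrier H ρ := by
  classical
  exact
  { toFun := fun v => ⟨fun g => if hg : g ∈ H then ρ ⟨g, hg⟩ v else 0, by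
      intro h g
      by_cases hg : g ∈ H
      · have h2 : (h : G) * g ∈ H := H.mul_mem h.2 hg
        have h3 : (⟨(h : G) * g, h2⟩ : H) = h * ⟨g, hg⟩ := rfl
        simp only [dif_pos h2, dif_pos hg]
        rw [h3, map_mul]; rfl
      · have h2 : (h : G) * g ∉ H := fun h3 => hg ((H.mul_mem_cancel_left h.2).1 h3)
        simp only [dif_neg h2, dif_neg hg, map_zero]⟩
    map_add' := by
      intro a b
      apply Subtype.ext; funext g
      by_cases hg : g ∈ H <;> simp [hg]
    map_smul' := by
      intro a b
      apply Subtype.ext; funext g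
      by_cases hg : g ∈ H <;> simp [hg] }

section helpers
variable {H : Subgroup G} {V : Type*} [AddCommGroup V] [Module ℂ V]
    {ρ : Representation ℂ H V}

lemma extZ_of_mem (v : V) (g : G) (hg : g ∈ H) : (extZ H ρ v : G → V) g = ρ ⟨g, hg⟩ v := by
  simp [extZ, hg]

lemma extZ_of_not_mem (v : V) (g : G) (hg : g ∉ H) : (extZ H ρ v : G → V) g = 0 := by
  simp [extZ, hg]

lemma extZ_one (v : V) : (extZ H ρ v : G → V) 1 = v := by
  rw [extZ_of_mem v 1 H.one_mem]
  have : (⟨1, H.one_mem⟩ : H) = 1 := rfl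
  rw [this, map_one]; rfl

lemma indRep_apply (g₀ g : G) (f : IndCarrier H ρ) :
    (indRep H ρ g₀ f : G → V) g = (f : G → V) (g * g₀) := rfl

lemma ind_apply_mem (f : IndCarrier H ρ) (g : G) (hg : g ∈ H) :
    (f : G → V) g = ρ ⟨g, hg⟩ ((f : G → V) 1) := by
  have := f.2 ⟨g, hg⟩ 1
  simpa using this

lemma eq_extZ (f : IndCarrier H ρ) (hf : ∀ g, g ∉ H → (f : G → V) g = 0) :
    f = extZ H ρ ((f : G → V) 1) := by
  apply Subtype.ext; funext g
  by_cases hg : g ∈ H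
  · rw [extZ_of_mem _ _ hg, ind_apply_mem f g hg]
  · rw [extZ_of_not_mem _ _ hg, hf g hg]

lemma extZ_rho (h : H) (v : V) : extZ H ρ (ρ h v) = indRep H ρ (h : G) (extZ H ρ v) := by
  symm
  have := eq_extZ (indRep H ρ (h : G) (extZ H ρ v)) (by
    intro g hg
    rw [indRep_apply]
    exact extZ_of_not_mem _ _ fun h3 => hg ((H.mul_mem_cancel_right h.2).1 h3))
  rw [this, indRep_apply, one_mul, extZ_of_mem _ _ h.2]

/-- decomposition over cosets -/
lemma ind_decomp [Fintype (G ⧸ H)] (f : IndCarrier H ρ) :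
    f = ∑ t : G ⧸ H, indRep H ρ t.out (extZ H ρ ((f : G → V) (t.out)⁻¹)) := by
  classical
  apply Subtype.ext; funext g
  rw [Submodule.coe_sum, Finset.sum_apply, Finset.sum_eq_single (QuotientGroup.mk g⁻¹ : G ⧸ H)]
  · rw [indRep_apply]
    have h1 : g * (QuotientGroup.mk g⁻¹ : G ⧸ H).out ∈ H := by
      have := QuotientGroup.eq.1 (QuotientGroup.out_eq' (QuotientGroup.mk g⁻¹ : G ⧸ H)).symm
      simpa using this
    rw [extZ_of_mem _ _ h1, ← f.2]
    congr 1
    simp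
  · intro t _ ht
    rw [indRep_apply]
    apply extZ_of_not_mem
    intro h1
    apply ht
    rw [← QuotientGroup.out_eq' t]
    symm
    rw [QuotientGroup.eq]
    simpa using h1
  · simp

variable {N : Subgroup G} {c : G → ℂ}

lemma ind_act (hN : N.Normal) (hNH : N ≤ H)
    (hact : ∀ h : H, (h : G) ∈ N → ∀ v, ρ h v = c h • v) (f : IndCarrier H ρ)
    (g n : G) (hn : n ∈ N) : (f : G → V) (g * n) = c (g * n * g⁻¹) • (f : G → V) g := by
  have h1 := hN.conj_mem n hn g
  rw [← hact ⟨_, hNH h1⟩ h1, ← f.2]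
  congr 1
  simp

lemma eigen_supp (hN : N.Normal) (hNH : N ≤ H)
    (hc : ∀ g, g ∈ H ↔ ∀ n ∈ N, c (g * n * g⁻¹) = c n)
    (hact : ∀ h : H, (h : G) ∈ N → ∀ v, ρ h v = c h • v) (f : IndCarrier H ρ)
    (hf : ∀ n ∈ N, indRep H ρ n f = c n • f) (g : G) (hg : g ∉ H) : (f : G → V) g = 0 := by
  by_contra h0
  apply hg
  rw [hc]
  intro n hn
  have h1 := ind_act hN hNH hact f g n hn
  have h2 := congrArg (fun f : IndCarrier H ρ => (f : G → V) g) (hf n hn)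
  simp only [indRep_apply, h1] at h2
  exact smul_left_injective ℂ h0 h2

lemma extZ_eigen (hN : N.Normal) (hNH : N ≤ H)
    (hc : ∀ g, g ∈ H ↔ ∀ n ∈ N, c (g * n * g⁻¹) = c n)
    (hact : ∀ h : H, (h : G) ∈ N → ∀ v, ρ h v = c h • v) (v : V)
    (n : G) (hn : n ∈ N) : indRep H ρ n (extZ H ρ v) = c n • extZ H ρ v := by
  have := extZ_rho (ρ := ρ) ⟨n, hNH hn⟩ v
  rw [← this, hact ⟨n, hNH hn⟩ hn, map_smul]

/-- an invariant nonzero subspace contains a nonzero function supported on `H` -/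
lemma exists_supp [Finite (G ⧸ H)] (hN : N.Normal) (hNH : N ≤ H)
    (hc : ∀ g, g ∈ H ↔ ∀ n ∈ N, c (g * n * g⁻¹) = c n)
    (hact : ∀ h : H, (h : G) ∈ N → ∀ v, ρ h v = c h • v)
    (q : Submodule ℂ (IndCarrier H ρ)) (hq : ∀ g : G, ∀ f ∈ q, indRep H ρ g f ∈ q)
    (hq0 : q ≠ ⊥) : ∃ v : V, v ≠ 0 ∧ extZ H ρ v ∈ q := by
  classical
  have : Fintype (G ⧸ H) := Fintype.ofFinite _
  obtain ⟨f, hf, hf0⟩ := q.ne_bot_iff.1 hq0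
  have key : ∀ S : Finset G, ∃ f ∈ q, (f : G → V) 1 ≠ 0 ∧
      ∀ g ∈ S, g ∉ H → (f : G → V) g = 0 := by
    intro S
    induction S using Finset.induction_on with
    | empty =>
      have : ∃ g, (f : G → V) g ≠ 0 := by
        by_contra! h
        exact hf0 (Subtype.ext (funext h))
      obtain ⟨g, hg⟩ := this
      refine ⟨indRep H ρ g f, hq g f hf, ?_, by simp⟩
      rwa [indRep_apply, one_mul]
    | insert g S _ ih =>
      obtain ⟨f, hf, h1, h2⟩ := ih
      by_cases hg : g ∈ H
      · refine ⟨f, hf, h1, ?_⟩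
        intro x hx hxH
        rcases Finset.mem_insert.1 hx with rfl | hx
        · exact absurd hg hxH
        · exact h2 x hx hxH
      · have h3 := hg
        rw [hc] at h3
        push Not at h3
        obtain ⟨n, hn, hne⟩ := h3
        have hval : ∀ x, ((indRep H ρ n f - c (g * n * g⁻¹) • f : IndCarrier H ρ) : G → V) x
            = (c (x * n * x⁻¹) - c (g * n * g⁻¹)) • (f : G → V) x := by
          intro x
          rw [sub_smul, ← ind_act hN hNH hact f x n hn]
          rfl
        refine ⟨indRep H ρ n f - c (g * n * g⁻¹) • f,
          q.sub_mem (hq n f hf) (q.smul_mem _ hf), ?_, ?_⟩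
        · rw [hval]
          refine smul_ne_zero ?_ h1
          simpa [sub_eq_zero] using hne.symm
        · intro x hx hxH
          rw [hval]
          rcases Finset.mem_insert.1 hx with rfl | hx
          · simp
          · rw [h2 x hx hxH, smul_zero]
  obtain ⟨f, hf, h1, h2⟩ := key (Finset.univ.image fun t : G ⧸ H => t.out⁻¹)
  refine ⟨_, h1, ?_⟩
  rw [← eq_extZ f]
  · exact hf
  · intro g hg
    have h3 : g * (QuotientGroup.mk g⁻¹ : G ⧸ H).out ∈ H := by
      have := QuotientGroup.eq.1 (QuotientGroup.out_eq' (QuotientGroup.mk g⁻¹ : G ⧸ H)).symm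
      simpa using this
    have h4 := f.2 ⟨_, h3⟩ (QuotientGroup.mk g⁻¹ : G ⧸ H).out⁻¹
    simp only [mul_inv_cancel_right] at h4
    rw [h4, h2 _ (Finset.mem_image_of_mem _ (Finset.mem_univ _)), map_zero]
    intro h5
    apply hg
    have := H.mul_mem h3 h5
    simpa using this

lemma ind_irred [Finite (G ⧸ H)] (hN : N.Normal) (hNH : N ≤ H)
    (hc : ∀ g, g ∈ H ↔ ∀ n ∈ N, c (g * n * g⁻¹) = c n)
    (hact : ∀ h : H, (h : G) ∈ N → ∀ v, ρ h v = c h • v)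
    (hρ : IsIrreducibleRep ρ) : IsIrreducibleRep (indRep H ρ) := by
  have : Fintype (G ⧸ H) := Fintype.ofFinite _
  obtain ⟨⟨u, hu⟩, hirr⟩ := hρ
  refine ⟨⟨extZ H ρ u, fun h => hu ?_⟩, ?_⟩
  · rw [← extZ_one (ρ := ρ) u, h]; rfl
  · intro q hq
    by_cases hq0 : q = ⊥
    · exact Or.inl hq0
    right
    obtain ⟨v, hv, hvq⟩ := exists_supp hN hNH hc hact q hq hq0
    rcases hirr (q.comap (extZ H ρ)) (by
      intro k u hu
      rw [Submodule.mem_comap] at hu ⊢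
      rw [extZ_rho]
      exact hq _ _ hu) with h | h
    · have : v ∈ q.comap (extZ H ρ) := hvq
      rw [h] at this
      exact absurd this hv
    · rw [eq_top_iff]
      intro f _
      rw [ind_decomp f]
      refine q.sum_mem fun t _ => hq _ _ ?_
      have : (f : G → V) (t.out)⁻¹ ∈ q.comap (extZ H ρ) := by rw [h]; trivial
      exact this

lemma irred_of_ind (h : IsIrreducibleRep (indRep H ρ)) : IsIrreducibleRep ρ := by
  obtain ⟨⟨f, hf⟩, hirr⟩ := h
  refine ⟨?_, ?_⟩
  · by_contra! h
    exact hf (Subtype.ext (funext fun g => h _))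
  · intro W hW
    let q : Submodule ℂ (IndCarrier H ρ) :=
      { carrier := {f | ∀ g, (f : G → V) g ∈ W}
        add_mem' := fun ha hb g => W.add_mem (ha g) (hb g)
        zero_mem' := fun g => W.zero_mem
        smul_mem' := fun a f hf g => W.smul_mem a (hf g) }
    have hext : ∀ w ∈ W, extZ H ρ w ∈ q := by
      intro w hw g
      by_cases hg : g ∈ H
      · rw [extZ_of_mem _ _ hg]; exact hW _ _ hw
      · rw [extZ_of_not_mem _ _ hg]; exact W.zero_mem
    rcases hirr q (fun k f hf g => hf (g * k)) with h | h
    · left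
      rw [eq_bot_iff]
      intro w hw
      have h1 := hext w hw
      rw [h, Submodule.mem_bot] at h1
      rw [Submodule.mem_bot, ← extZ_one (ρ := ρ) w, h1]; rfl
    · right
      rw [eq_top_iff]
      intro v _
      have h1 : extZ H ρ v ∈ q := by rw [h]; trivial
      have := h1 1
      rwa [extZ_one] at this

lemma irred_of_iso {K : Type*} [Group K] {U₁ U₂ : Type*} [AddCommGroup U₁] [Module ℂ U₁]
    [AddCommGroup U₂] [Module ℂ U₂]
    {π₁ : Representation ℂ K U₁} {π₂ : Representation ℂ K U₂} (h : RepIso π₁ π₂)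
    (h2 : IsIrreducibleRep π₂) : IsIrreducibleRep π₁ := by
  obtain ⟨e, he⟩ := h
  obtain ⟨⟨u, hu⟩, hirr⟩ := h2
  refine ⟨⟨e.symm u, by simpa using hu⟩, ?_⟩
  intro q hq
  have hm : ∀ x, x ∈ q.comap (e.symm : U₂ →ₗ[ℂ] U₁) ↔ e.symm x ∈ q := fun x => Iff.rfl
  rcases hirr (q.comap (e.symm : U₂ →ₗ[ℂ] U₁)) (by
    intro k u hu
    rw [hm] at hu ⊢
    have := hq k _ hu
    have h3 : e.symm (π₂ k u) = π₁ k (e.symm u) := by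
      rw [LinearEquiv.symm_apply_eq, he, LinearEquiv.apply_symm_apply]
    rwa [h3]) with h | h
  · left
    rw [eq_bot_iff]
    intro x hx
    have : e x ∈ q.comap (e.symm : U₂ →ₗ[ℂ] U₁) := by rw [hm]; simpa using hx
    rw [h] at this
    simpa using this
  · right
    rw [eq_top_iff]
    intro x _
    have : e x ∈ q.comap (e.symm : U₂ →ₗ[ℂ] U₁) := by rw [h]; trivial
    rw [hm] at this
    simpa using this

/-- the `χ`-eigenspace -/
def eigSp {K : Type*} [Group K] {U : Type*} [AddCommGroup U] [Module ℂ U]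
    (π : Representation ℂ K U) (S : Set K) (c : K → ℂ) : Submodule ℂ U where
  carrier := {u | ∀ n ∈ S, π n u = c n • u}
  add_mem' := by
    intro a b ha hb n hn
    rw [map_add, ha n hn, hb n hn, smul_add]
  zero_mem' := by intro n _; simp
  smul_mem' := by
    intro a u hu n hn
    rw [map_smul, hu n hn, smul_comm]

lemma eigSp_stable {K : Type*} [Group K] {U : Type*} [AddCommGroup U] [Module ℂ U]
    (π : Representation ℂ K U) (S : Set K) (c : K → ℂ) (k : K)
    (hS : ∀ n ∈ S, k⁻¹ * n * k ∈ S) (hk : ∀ n ∈ S, c (k⁻¹ * n * k) = c n) (u : U)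
    (hu : u ∈ eigSp π S c) : π k u ∈ eigSp π S c := by
  intro n hn
  have h1 := hu _ (hS n hn)
  have h2 : π n (π k u) = π k (π (k⁻¹ * n * k) u) := by
    rw [← Module.End.mul_apply, ← Module.End.mul_apply, ← map_mul, ← map_mul]
    congr 2
    group
  rw [h2, h1, map_smul, hk n hn]

lemma act_of_irred (hN : N.Normal)
    (hc : ∀ g, g ∈ H ↔ ∀ n ∈ N, c (g * n * g⁻¹) = c n)
    (hρ : IsIrreducibleRep ρ)
    (hcont : ∃ u : V, u ≠ 0 ∧ ∀ h : H, (h : G) ∈ N → ρ h u = c h • u) :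
    ∀ h : H, (h : G) ∈ N → ∀ v, ρ h v = c h • v := by
  obtain ⟨u, hu, huN⟩ := hcont
  rcases hρ.2 (eigSp ρ {h : H | (h : G) ∈ N} (fun h => c h)) (by
    intro k v hv
    refine eigSp_stable ρ _ _ k ?_ ?_ v hv
    · intro n hn
      have := hN.conj_mem _ hn (k : G)⁻¹
      simpa using this
    · intro n hn
      have := (hc _).1 (H.inv_mem k.2) n hn
      simpa using this) with h | h
  · have : u ∈ eigSp ρ {h : H | (h : G) ∈ N} (fun h => c h) := huN
    rw [h] at this
    exact absurd this hu
  · intro k hk v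
    have : v ∈ eigSp ρ {h : H | (h : G) ∈ N} (fun h => c h) := by rw [h]; trivial
    exact this k hk

lemma part_two [Finite (G ⧸ H)] (hN : N.Normal) (hNH : N ≤ H)
    (hc : ∀ g, g ∈ H ↔ ∀ n ∈ N, c (g * n * g⁻¹) = c n)
    {U : Type*} [AddCommGroup U] [Module ℂ U] (π : Representation ℂ G U)
    (hπ : IsIrreducibleRep π)
    (hcont : ∃ u : U, u ≠ 0 ∧ ∀ n ∈ N, π n u = c n • u) :
    ∃ (Vs : Submodule ℂ U) (ρ : Representation ℂ H Vs),
      IsIrreducibleRep ρ ∧ (∃ u : Vs, u ≠ 0 ∧ ∀ h : H, (h : G) ∈ N → ρ h u = c h • u) ∧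
        RepIso (indRep H ρ) π := by
  classical
  have : Fintype (G ⧸ H) := Fintype.ofFinite _
  obtain ⟨u₀, hu₀, hu₀N⟩ := hcont
  let W := eigSp π (N : Set G) c
  have hW : ∀ h : H, ∀ w ∈ W, π h w ∈ W := by
    intro h w hw
    refine eigSp_stable π _ _ (h : G) ?_ ?_ w hw
    · intro n hn
      have := hN.conj_mem _ hn (h : G)⁻¹
      simpa using this
    · intro n hn
      have := (hc _).1 (H.inv_mem h.2) n hn
      simpa using this
  let ρ : Representation ℂ H W :=
    { toFun := fun h => (π h).restrict (hW h)
      map_one' := by ext w; simp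
      map_mul' := by intro a b; ext w; simp }
  have hρ : ∀ h w, ((ρ h w : W) : U) = π h w := fun h w => rfl
  have hact : ∀ h : H, (h : G) ∈ N → ∀ v, ρ h v = c h • v := by
    intro h hh v
    apply Subtype.ext
    exact v.2 h hh
  let Φ : IndCarrier H ρ →ₗ[ℂ] U :=
    { toFun := fun f => ∑ t : G ⧸ H, π t.out ((f : G → W) (t.out)⁻¹ : U)
      map_add' := by
        intro a b
        simp [Finset.sum_add_distrib]
      map_smul' := by
        intro a b
        simp [Finset.smul_sum] }
  have hwd : ∀ (f : IndCarrier H ρ) (x : G),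
      π (QuotientGroup.mk x : G ⧸ H).out ((f : G → W) ((QuotientGroup.mk x : G ⧸ H).out)⁻¹ : U)
        = π x ((f : G → W) x⁻¹ : U) := by
    intro f x
    obtain ⟨h, hh⟩ := QuotientGroup.mk_out_eq_mul H x
    rw [hh, mul_inv_rev]
    have := f.2 h⁻¹ x⁻¹
    rw [Subgroup.coe_inv] at this
    rw [this, hρ, ← Module.End.mul_apply, ← map_mul]
    simp
  have hΦ : ∀ (g : G) (f), Φ (indRep H ρ g f) = π g (Φ f) := by
    intro g f
    change ∑ t : G ⧸ H, π t.out ((f : G → W) ((t.out)⁻¹ * g) : U) =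
      π g (∑ t : G ⧸ H, π t.out ((f : G → W) (t.out)⁻¹ : U))
    rw [map_sum]
    symm
    refine Fintype.sum_equiv (MulAction.toPerm g) _ _ fun t => ?_
    have e1 := hwd (indRep H ρ g f) (g * t.out)
    simp only [indRep_apply] at e1
    have e2 : (MulAction.toPerm g) t = (QuotientGroup.mk (g * t.out) : G ⧸ H) := by
      conv_lhs => rw [← QuotientGroup.out_eq' t]
      rfl
    rw [e2, e1, map_mul]
    simp
  have hΦe : ∀ w : W, Φ (extZ H ρ w) = w := by
    intro w
    change ∑ t : G ⧸ H, π t.out ((extZ H ρ w : G → W) (t.out)⁻¹ : U) = w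
    rw [Finset.sum_eq_single (QuotientGroup.mk 1 : G ⧸ H)]
    · rw [hwd, inv_one, extZ_one, map_one]; rfl
    · intro t _ ht
      rw [extZ_of_not_mem]
      · simp
      · intro h1
        apply ht
        rw [← QuotientGroup.out_eq' t, QuotientGroup.eq]
        simpa using h1
    · simp
  have hinj : LinearMap.ker Φ = ⊥ := by
    by_contra hne
    obtain ⟨v, hv, hvk⟩ := exists_supp hN hNH hc hact (LinearMap.ker Φ) (by
      intro g f hf
      rw [LinearMap.mem_ker] at hf ⊢
      rw [hΦ, hf, map_zero]) hne
    rw [LinearMap.mem_ker, hΦe] at hvk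
    exact hv (Subtype.ext hvk)
  let w₀ : W := ⟨u₀, hu₀N⟩
  have hsurj : LinearMap.range Φ = ⊤ := by
    rcases hπ.2 (LinearMap.range Φ) (by
      rintro k _ ⟨f, rfl⟩
      exact ⟨_, hΦ k f⟩) with h | h
    · have : (w₀ : U) ∈ LinearMap.range Φ := ⟨_, hΦe w₀⟩
      rw [h] at this
      exact absurd this hu₀
    · exact h
  have hiso : RepIso (indRep H ρ) π :=
    ⟨LinearEquiv.ofBijective Φ ⟨LinearMap.ker_eq_bot.1 hinj, LinearMap.range_eq_top.1 hsurj⟩,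
      fun k u => hΦ k u⟩
  refine ⟨W, ρ, irred_of_ind (irred_of_iso hiso hπ), ⟨w₀, ?_, ?_⟩, hiso⟩
  · intro h
    exact hu₀ (congrArg Subtype.val h)
  · intro h hh
    exact hact h hh w₀

lemma part_three_aux {V₂ : Type*} [AddCommGroup V₂] [Module ℂ V₂] {ρ₂ : Representation ℂ H V₂}
    (hN : N.Normal) (hNH : N ≤ H)
    (hc : ∀ g, g ∈ H ↔ ∀ n ∈ N, c (g * n * g⁻¹) = c n)
    (hact : ∀ h : H, (h : G) ∈ N → ∀ v, ρ h v = c h • v)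
    (hact₂ : ∀ h : H, (h : G) ∈ N → ∀ v, ρ₂ h v = c h • v)
    (e : IndCarrier H ρ →ₗ[ℂ] IndCarrier H ρ₂)
    (he : ∀ g f, e (indRep H ρ g f) = indRep H ρ₂ g (e f)) (v : V) :
    extZ H ρ₂ ((e (extZ H ρ v) : G → V₂) 1) = e (extZ H ρ v) := by
  symm
  apply eq_extZ
  apply eigen_supp hN hNH hc hact₂
  intro n hn
  rw [← he, extZ_eigen hN hNH hc hact v n hn, map_smul]

lemma part_three {V₂ : Type*} [AddCommGroup V₂] [Module ℂ V₂] {ρ₂ : Representation ℂ H V₂}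
    (hN : N.Normal) (hNH : N ≤ H)
    (hc : ∀ g, g ∈ H ↔ ∀ n ∈ N, c (g * n * g⁻¹) = c n)
    (hact : ∀ h : H, (h : G) ∈ N → ∀ v, ρ h v = c h • v)
    (hact₂ : ∀ h : H, (h : G) ∈ N → ∀ v, ρ₂ h v = c h • v)
    (hiso : RepIso (indRep H ρ) (indRep H ρ₂)) : RepIso ρ ρ₂ := by
  obtain ⟨e, he⟩ := hiso
  have he' : ∀ g f, e.symm (indRep H ρ₂ g f) = indRep H ρ g (e.symm f) := by
    intro g f
    rw [LinearEquiv.symm_apply_eq, he, LinearEquiv.apply_symm_apply]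
  have a1 := part_three_aux hN hNH hc hact hact₂ e.toLinearMap he
  have a2 := part_three_aux hN hNH hc hact₂ hact e.symm.toLinearMap he'
  simp only [LinearEquiv.coe_coe] at a1 a2
  refine ⟨{ toFun := fun v => (e (extZ H ρ v) : G → V₂) 1
            invFun := fun v => (e.symm (extZ H ρ₂ v) : G → V) 1
            map_add' := ?_
            map_smul' := ?_
            left_inv := ?_
            right_inv := ?_ }, ?_⟩
  · intro a b; rw [map_add, map_add]; rfl
  · intro a b; rw [map_smul, map_smul]; rfl
  · intro v
    simp only [a1, LinearEquiv.symm_apply_apply, extZ_one]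
  · intro v
    simp only [a2, LinearEquiv.apply_symm_apply, extZ_one]
  · intro k u
    change (e (extZ H ρ (ρ k u)) : G → V₂) 1 = ρ₂ k ((e (extZ H ρ u) : G → V₂) 1)
    rw [extZ_rho, he, indRep_apply, one_mul, ind_apply_mem _ _ k.2]

end helpers

/-- **Clifford theory for characters of an abelian normal subgroup of finite
index: induction from the stabilizer is a bijection.**  `N` is an abelian normal
subgroup of `G` of finite index, `χ : N → ℂˣ` a character, and `H` its stabilizer
in `G`.  Then: (i) induction sends finite-dimensional irreducible representations
of `H` containing `χ` to irreducible representations of `G` containing `χ`;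
(ii) every finite-dimensional irreducible representation of `G` containing `χ` is
induced from a finite-dimensional irreducible representation of `H` containing
`χ`; (iii) induction is injective up to isomorphism on such representations. -/
theorem clifford_induction_bijection
    (N : Subgroup G) (hN : N.Normal)
    (hNab : ∀ a b : N, a * b = b * a) (hfin : N.FiniteIndex)
    (χ : N →* ℂˣ)
    (H : Subgroup G)
    (hH : ∀ g : G, g ∈ H ↔ ∀ (n : G) (hn : n ∈ N) (hgn : g⁻¹ * n * g ∈ N),
      χ ⟨g⁻¹ * n * g, hgn⟩ = χ ⟨n, hn⟩)
    (hNH : N ≤ H) :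
    -- (i) induction preserves irreducibility and containment of `χ`
    (∀ (V : Type) [AddCommGroup V] [Module ℂ V] [FiniteDimensional ℂ V]
      (ρ : Representation ℂ H V),
      IsIrreducibleRep ρ → ContainsChi N χ hNH ρ →
        IsIrreducibleRep (indRep H ρ) ∧ ContainsChiG N χ (indRep H ρ)) ∧
    -- (ii) every irreducible representation of `G` containing `χ` is induced
    (∀ (U : Type) [AddCommGroup U] [Module ℂ U] [FiniteDimensional ℂ U]
      (π : Representation ℂ G U),
      IsIrreducibleRep π → ContainsChiG N χ π →
        ∃ (Vs : Submodule ℂ U) (ρ : Representation ℂ H Vs),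
          FiniteDimensional ℂ Vs ∧ IsIrreducibleRep ρ ∧ ContainsChi N χ hNH ρ ∧
            RepIso (indRep H ρ) π) ∧
    -- (iii) induction is injective up to isomorphism
    (∀ (V₁ V₂ : Type) [AddCommGroup V₁] [Module ℂ V₁] [AddCommGroup V₂]
      [Module ℂ V₂] [FiniteDimensional ℂ V₁] [FiniteDimensional ℂ V₂]
      (ρ₁ : Representation ℂ H V₁) (ρ₂ : Representation ℂ H V₂),
      IsIrreducibleRep ρ₁ → ContainsChi N χ hNH ρ₁ →
      IsIrreducibleRep ρ₂ → ContainsChi N χ hNH ρ₂ →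
      RepIso (indRep H ρ₁) (indRep H ρ₂) → RepIso ρ₁ ρ₂) := by
  classical
  have hHfin : H.FiniteIndex := Subgroup.finiteIndex_of_le hNH
  have : Finite (G ⧸ H) := inferInstance
  let c : G → ℂ := fun n => if hn : n ∈ N then ((χ ⟨n, hn⟩ : ℂˣ) : ℂ) else 0
  have hcN : ∀ n (hn : n ∈ N), c n = ((χ ⟨n, hn⟩ : ℂˣ) : ℂ) := fun n hn => dif_pos hn
  have hc : ∀ g, g ∈ H ↔ ∀ n ∈ N, c (g * n * g⁻¹) = c n := by
    intro g
    rw [← H.inv_mem_iff, hH]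
    simp only [inv_inv]
    constructor
    · intro h n hn
      rw [hcN _ hn, hcN _ (hN.conj_mem n hn g), h n hn (hN.conj_mem n hn g)]
    · intro h n hn hgn
      have := h n hn
      rw [hcN _ hn, hcN _ hgn] at this
      exact Units.ext this
  have hcont : ∀ {V : Type} [AddCommGroup V] [Module ℂ V] (ρ : Representation ℂ H V),
      ContainsChi N χ hNH ρ ↔
        ∃ u : V, u ≠ 0 ∧ ∀ h : H, (h : G) ∈ N → ρ h u = c h • u := by
    intro V _ _ ρ
    refine exists_congr fun u => and_congr_right fun _ => ⟨?_, ?_⟩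
    · intro h k hk
      rw [hcN _ hk]
      exact h k hk
    · intro h n hn
      rw [← hcN]
      exact h ⟨n, hNH hn⟩ hn
  refine ⟨?_, ?_, ?_⟩
  · intro V _ _ _ ρ hρ hχ
    have hact := act_of_irred hN hc hρ ((hcont ρ).1 hχ)
    refine ⟨ind_irred hN hNH hc hact hρ, ?_⟩
    obtain ⟨u, hu, -⟩ := hχ
    refine ⟨extZ H ρ u, fun h => hu ?_, ?_⟩
    · rw [← extZ_one (ρ := ρ) u, h]; rfl
    · intro n hn
      rw [← hcN]
      exact extZ_eigen hN hNH hc hact u n hn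
  · intro U _ _ _ π hπ hχ
    obtain ⟨u, hu, huN⟩ := hχ
    obtain ⟨W, ρ, h1, h2, h3⟩ := part_two hN hNH hc π hπ
      ⟨u, hu, fun n hn => by rw [hcN n hn]; exact huN n hn⟩
    exact ⟨W, ρ, inferInstance, h1, (hcont ρ).2 h2, h3⟩
  · intro V₁ V₂ _ _ _ _ _ _ ρ₁ ρ₂ h1 c1 h2 c2 hiso
    exact part_three hN hNH hc (act_of_irred hN hc h1 ((hcont ρ₁).1 c1))
      (act_of_irred hN hc h2 ((hcont ρ₂).1 c2)) hiso

end Stmt9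
end

section
/- The fiber of twisted rational points over α is identified with a fiber of the first hypercohomology of the complex T → T, t ↦ t·α(t)⁻¹: the assignment t ↦ [(z⁻¹, t)], where z⁻¹(σ) := z(σ)⁻¹, maps F_α(z) into Z¹(Γ, T →(1−α)→ T) and induces a well-defined bijection from F_α(z)/∼ onto the set of classes [(c,u)] in Z¹(Γ, T →(1−α)→ T)/B¹ whose first component c is cohomologous to z⁻¹ (i.e. there exists t₁ ∈ T with c(σ) = z(σ)⁻¹·t₁⁻¹·(σ•t₁) for all σ). Moreover, this bijection is equivariant for both the left and the right translation actions of T^Γ: for t₀ ∈ T^Γ, the class of t₀·t corresponds to [(z⁻¹, t₀·t)] and the class of t·α(t₀) corresponds to the class [(z⁻¹, t·t₀)]. -/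
namespace Stmt12

variable {Γ T : Type*} [Group Γ] [CommGroup T] [MulDistribMulAction Γ T]

/-- The set `F_α(z)` of twisted points: `t ∈ T` with
`z(σ)·(σ•t)·α(z(σ))⁻¹ = t` for all `σ ∈ Γ`. -/
def Fset (α : T ≃* T) (z : Γ → T) : Set T :=
  {t | ∀ σ : Γ, z σ * σ • t * (α (z σ))⁻¹ = t}

/-- `(c,u)` is a 1-hypercocycle for the complex `T →(1−α)→ T`: `c` is a 1-cocycle
and `c(σ)·α(c(σ))⁻¹ = u⁻¹·(σ•u)` for all `σ`. -/
def IsHypercocycle (α : T ≃* T) (c : Γ → T) (u : T) : Prop :=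
  (∀ σ τ : Γ, c (σ * τ) = c σ * σ • c τ) ∧
    ∀ σ : Γ, c σ * (α (c σ))⁻¹ = u⁻¹ * σ • u

/-- Two 1-hypercocycles `(c,u)` and `(c',u')` are cohomologous (differ by the
1-hypercoboundary attached to some `t₀ ∈ T`). -/
def CohRel (α : T ≃* T) (c c' : Γ → T) (u u' : T) : Prop :=
  ∃ t₀ : T, (∀ σ : Γ, c σ = c' σ * t₀⁻¹ * σ • t₀) ∧ u = u' * t₀ * (α t₀)⁻¹

/-- **The fiber of twisted rational points is identified with a fiber of the first
hypercohomology of `T →(1−α)→ T`.**  For a `Γ`-equivariant automorphism `α` of the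
abelian group `T` and a 1-cocycle `z`, the assignment `t ↦ [(z⁻¹, t)]`:
(1) maps `F_α(z)` into the 1-hypercocycles; (2) induces a well-defined injection on
classes; (3) surjects onto the classes whose first component is cohomologous to
`z⁻¹`; and (4) is equivariant for the left and right translation actions of `T^Γ`
(the class of `t·α(t₀)` corresponding to `[(z⁻¹, t·t₀)]`). -/
theorem twisted_space_bijection
    (α : T ≃* T) (hα : ∀ (σ : Γ) (t : T), α (σ • t) = σ • α t)
    (z : Γ → T) (hz : ∀ σ τ : Γ, z (σ * τ) = z σ * σ • z τ) :
    -- (1) the map lands in the 1-hypercocycles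
    (∀ t ∈ Fset α z, IsHypercocycle α (fun σ => (z σ)⁻¹) t) ∧
    -- (2) well-definedness and injectivity on classes
    (∀ t ∈ Fset α z, ∀ t' ∈ Fset α z,
      ((∃ t₀ : T, (∀ σ : Γ, σ • t₀ = t₀) ∧ t' = t * t₀ * (α t₀)⁻¹) ↔
        CohRel α (fun σ => (z σ)⁻¹) (fun σ => (z σ)⁻¹) t' t)) ∧
    -- (3) surjectivity onto the fiber over the classes with first component
    -- cohomologous to `z⁻¹`
    (∀ (c : Γ → T) (u : T), IsHypercocycle α c u →
      (∃ t₁ : T, ∀ σ : Γ, c σ = (z σ)⁻¹ * t₁⁻¹ * σ • t₁) →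
      ∃ t ∈ Fset α z, CohRel α c (fun σ => (z σ)⁻¹) u t) ∧
    -- (4) equivariance for the left and right actions of `T^Γ`
    (∀ t ∈ Fset α z, ∀ t₀ : T, (∀ σ : Γ, σ • t₀ = t₀) →
      t₀ * t ∈ Fset α z ∧ t * α t₀ ∈ Fset α z ∧
        CohRel α (fun σ => (z σ)⁻¹) (fun σ => (z σ)⁻¹) (t * α t₀) (t * t₀)) := by
  have key : ∀ t : T, t ∈ Fset α z ↔ ∀ σ : Γ, σ • t = t * (z σ)⁻¹ * α (z σ) := by
    intro t
    refine forall_congr' fun σ => ?_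
    rw [mul_inv_eq_iff_eq_mul, mul_comm (z σ), ← eq_mul_inv_iff_mul_eq, mul_right_comm]
  refine ⟨?_, ?_, ?_, ?_⟩
  · intro t ht
    rw [key] at ht
    refine ⟨fun σ τ => ?_, fun σ => ?_⟩
    · simp only [hz, smul_inv', mul_inv]
    · simp only [ht σ, map_inv, inv_inv]
      rw [mul_assoc, inv_mul_cancel_left]
  · intro t ht t' ht'
    refine exists_congr fun t₀ => and_congr_left fun _ => forall_congr' fun σ => ?_
    rw [mul_assoc, left_eq_mul, inv_mul_eq_one, eq_comm]
  · rintro c u ⟨hc, hu⟩ ⟨t₁, h₁⟩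
    refine ⟨u * t₁⁻¹ * α t₁, ?_, t₁, h₁, ?_⟩
    · rw [key]
      intro σ
      have h := hu σ
      rw [eq_inv_mul_iff_mul_eq] at h
      simp only [smul_mul', smul_inv', ← hα, ← h, h₁ σ, map_mul, map_inv, mul_inv, inv_inv]
      apply Additive.ofMul.injective
      simp only [ofMul_mul, ofMul_inv]
      abel
    · apply Additive.ofMul.injective
      simp only [ofMul_mul, ofMul_inv]
      abel
  · intro t ht t₀ h₀
    rw [key] at ht
    refine ⟨(key _).2 fun σ => ?_, (key _).2 fun σ => ?_, t₀⁻¹, fun σ => ?_, ?_⟩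
    · simp only [smul_mul', h₀, ht σ, mul_assoc]
    · simp only [smul_mul', ← hα, h₀, ht σ]
      simp only [mul_assoc, mul_comm, mul_left_comm]
    · simp [smul_inv', h₀]
    · simp

end Stmt12
end
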